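/- Let P : g → g and Q : g → g both be ad-equivariant. Then the fields P and Q commute pointwise: [P(x), Q(x)] = 0 for every x ∈ g. -/

import Mathlib

theorem stmt {g : Type*} [NormedAddCommGroup g] [NormedSpace ℂ g] [FiniteDimensional ℂ g]
    -- `lie` is the Lie bracket of the finite-dimensional complex Lie algebra `g`,
    -- given as bilinear data so that it is compatible with the normed space structure.
    (lie : g →ₗ[ℂ] g →ₗ[ℂ] g)
    (lie_self : ∀ x : g, lie x x = 0)
    (lie_jacobi : ∀ x y z : g, lie x (lie y z) = lie (lie x y) z + lie y (lie x z))
    (P Q : g → g) (hP : ContDiff ℂ ⊤ P) (hQ : ContDiff ℂ ⊤ Q)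
    (hPeq : ∀ x y : g, fderiv ℂ P x (lie y x) = lie y (P x))
    (hQeq : ∀ x y : g, fderiv ℂ Q x (lie y x) = lie y (Q x))
    (x : g) :
    lie (P x) (Q x) = 0 := by
  have lie_x_P : lie x (P x) = 0 := by rw [← hPeq, lie_self, map_zero]
  have lie_P_x : lie (P x) x = 0 := by
    have h := lie_self (x + P x)
    simpa [lie_self, lie_x_P] using h
  rw [← hQeq, lie_P_x, map_zero]
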